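/- For every real x with 0 < x ≤ 1, the limit as n → ∞ of n · Σ_{k=0}^{n} p_{n,k}(x) · ( sqrt(k(k-1)/(n(n-1))) - k/n )^2 equals 0. -/

import Mathlib

open Filter Finset

/-- Bernstein basis polynomial `p_{n,k}(x) = C(n,k) x^k (1-x)^{n-k}`. -/
noncomputable def bern (n k : ℕ) (x : ℝ) : ℝ := (n.choose k : ℝ) * x ^ k * (1 - x) ^ (n - k)

theorem bern_nonneg (n k : ℕ) {x : ℝ} (hx0 : 0 ≤ x) (hx1 : x ≤ 1) : 0 ≤ bern n k x := by
  have : 0 ≤ 1 - x := sub_nonneg.2 hx1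
  unfold bern
  positivity

theorem sum_bern (n : ℕ) (x : ℝ) : ∑ k ∈ Finset.range (n + 1), bern n k x = 1 := by
  have h := add_pow x (1 - x) n
  rw [add_sub_cancel, one_pow] at h
  rw [h]
  exact Finset.sum_congr rfl fun k _ => by unfold bern; ring

/-- The modified node `√(k(k-1)/(n(n-1)))` lies within `1/n` of the node `k/n`. -/
theorem sq_sqrt_node_sub_node_le {n k : ℕ} (hn : 2 ≤ n) (hk : k ≤ n) :
    (Real.sqrt ((k * (k - 1)) / (n * (n - 1))) - (k : ℝ) / n) ^ 2 ≤ 1 / (n : ℝ) ^ 2 := by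
  rcases Nat.eq_zero_or_pos k with rfl | hk0
  · simp
  have hn' : (2 : ℝ) ≤ n := by exact_mod_cast hn
  have hk' : (k : ℝ) ≤ n := by exact_mod_cast hk
  have hk1 : (1 : ℝ) ≤ k := by exact_mod_cast hk0
  have hn0 : (0 : ℝ) < n := by linarith
  have hn1 : (0 : ℝ) < n - 1 := by linarith
  have upper : Real.sqrt ((k * (k - 1)) / (n * (n - 1))) ≤ (k : ℝ) / n := by
    apply Real.sqrt_le_iff.2 ⟨by positivity, ?_⟩
    rw [div_pow, div_le_div_iff₀ (by positivity) (by positivity)]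
    have : 0 ≤ (k : ℝ) * n * (n - k) := mul_nonneg (by positivity) (by linarith)
    linarith
  have lower : ((k : ℝ) - 1) / n ≤ Real.sqrt ((k * (k - 1)) / (n * (n - 1))) := by
    apply Real.le_sqrt_of_sq_le
    rw [div_pow, div_le_div_iff₀ (by positivity) (by positivity)]
    have : 0 ≤ ((k : ℝ) - 1) * n * (n + k - 1) :=
      mul_nonneg (mul_nonneg (by linarith) hn0.le) (by linarith)
    linarith
  rw [sub_div] at lower
  rw [← one_div_pow]
  exact sq_le_sq' (by linarith) (by linarith [one_div_pos.2 hn0])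

theorem stmt_6 (x : ℝ) (hx0 : 0 < x) (hx1 : x ≤ 1) :
    Tendsto (fun n : ℕ => (n : ℝ) * ∑ k ∈ Finset.range (n + 1),
        bern n k x * (Real.sqrt ((k * (k - 1)) / (n * (n - 1))) - (k : ℝ) / n) ^ 2)
      atTop (nhds 0) := by
  refine squeeze_zero' (.of_forall fun n => ?_) ?_ tendsto_one_div_atTop_nhds_zero_nat
  · exact mul_nonneg n.cast_nonneg
      (Finset.sum_nonneg fun k _ => mul_nonneg (bern_nonneg n k hx0.le hx1) (sq_nonneg _))
  filter_upwards [eventually_ge_atTop 2] with n hn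
  have hn0 : (n : ℝ) ≠ 0 := by positivity
  calc _ ≤ (n : ℝ) * ∑ k ∈ Finset.range (n + 1), bern n k x * (1 / (n : ℝ) ^ 2) := by
        gcongr with k hk
        · exact bern_nonneg n k hx0.le hx1
        · exact sq_sqrt_node_sub_node_le hn (Finset.mem_range_succ_iff.1 hk)
    _ = 1 / n := by
        rw [← Finset.sum_mul, sum_bern]
        field_simp
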